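/- Assume additionally that c is a regular value of C : U → ℝ. Then for every smooth function α : V → (0,∞), the set Γ is a periodic orbit of the perturbed system dv/dt = X(v) − α(v)(H(v)−h)[∇C(v) × (∇H(v) × ∇C(v))], v ∈ V, and Γ is orbitally phase asymptotically stable with respect to perturbations in the invariant set C⁻¹({c}) ∩ V. -/

import Mathlib

open scoped RealInnerProductSpace

noncomputable section

abbrev E3 := EuclideanSpace ℝ (Fin 3)

/-- The cross product on `EuclideanSpace ℝ (Fin 3)`. -/
noncomputable def cross3 (a b : E3) : E3 :=
  (WithLp.equiv 2 (Fin 3 → ℝ)).symm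
    (crossProduct (WithLp.equiv 2 (Fin 3 → ℝ) a) (WithLp.equiv 2 (Fin 3 → ℝ) b))

/-- `x` is a forward-in-time solution of `v' = Y v` in `V` with `x 0 = x₀`. -/
def IsForwardSolution {E : Type*} [NormedAddCommGroup E] [NormedSpace ℝ E]
    (Y : E → E) (V : Set E) (x₀ : E) (x : ℝ → E) : Prop :=
  x 0 = x₀ ∧ ∀ t : ℝ, 0 ≤ t → x t ∈ V ∧ HasDerivWithinAt x (Y (x t)) (Set.Ici 0) t

/-- Orbital stability of the set `Γ` for the system `v' = Y v` on `V`,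
with respect to perturbations (initial conditions) in `S`. -/
def OrbitallyStable {E : Type*} [NormedAddCommGroup E] [NormedSpace ℝ E]
    (Y : E → E) (V S Γ : Set E) : Prop :=
  ∀ ε > 0, ∃ δ' > 0, ∀ x₀ ∈ S, Metric.infDist x₀ Γ < δ' →
    ∀ x : ℝ → E, IsForwardSolution Y V x₀ x → ∀ t ≥ (0:ℝ), Metric.infDist (x t) Γ < ε

/-- Orbital phase asymptotic stability of the periodic orbit `Γ` (traced by `γ`)
for the system `v' = Y v` on `V`, with respect to perturbations in `S`. -/
def OrbitallyPhaseAsymptoticallyStable {E : Type*} [NormedAddCommGroup E] [NormedSpace ℝ E]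
    (Y : E → E) (V S : Set E) (γ : ℝ → E) (Γ : Set E) : Prop :=
  ∃ δ > 0,
    (∀ x₀ ∈ S, Metric.infDist x₀ Γ < δ → ∃ x : ℝ → E, IsForwardSolution Y V x₀ x) ∧
    (∀ ε > 0, ∃ δ' > 0, δ' ≤ δ ∧ ∀ x₀ ∈ S, Metric.infDist x₀ Γ < δ' →
      ∀ x : ℝ → E, IsForwardSolution Y V x₀ x → ∀ t ≥ (0:ℝ), Metric.infDist (x t) Γ < ε) ∧
    (∀ x₀ ∈ S, Metric.infDist x₀ Γ < δ → ∀ x : ℝ → E, IsForwardSolution Y V x₀ x →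
      Filter.Tendsto (fun t => Metric.infDist (x t) Γ) Filter.atTop (nhds 0) ∧
      ∃ θ₀ : ℝ, Filter.Tendsto (fun t => dist (x t) (γ (t + θ₀))) Filter.atTop (nhds 0))

open Set Filter Topology

/-- A `C¹` vector field agrees on a compact set with a globally Lipschitz, bounded one. -/
theorem exists_lipschitzWith_bounded_eqOn {E : Type*} [NormedAddCommGroup E] [NormedSpace ℝ E]
    [FiniteDimensional ℝ E] {Y : E → E} {V K : Set E} (hV : IsOpen V) (hK : IsCompact K)
    (hKV : K ⊆ V) (hY : ContDiffOn ℝ 1 Y V) :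
    ∃ (Z : E → E) (L B : NNReal), LipschitzWith L Z ∧ (∀ x, ‖Z x‖ ≤ B) ∧ EqOn Z Y K := by
  obtain ⟨K', hK', hKK', hK'V⟩ := exists_compact_between hK hV hKV
  obtain ⟨f, hf1, hf0, -⟩ := exists_contMDiffMap_one_nhds_of_subset_interior (n := 1)
    (modelWithCornersSelf ℝ E) hK.isClosed hKK'
  have hfd : ContDiff ℝ 1 f := f.contMDiff.contDiff
  have hts : tsupport f ⊆ K' := closure_minimal
    (fun x hx => by_contra fun hx' => hx (hf0 x hx')) hK'.isClosed
  have hsub : tsupport (fun x => f x • Y x) ⊆ tsupport f :=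
    closure_mono (Function.support_smul_subset_left _ _)
  have hZ : ContDiff ℝ 1 fun x => f x • Y x := by
    refine contMDiff_iff_contDiff.1 (contMDiff_of_tsupport fun x hx => ?_)
    exact (hfd.contDiffAt.smul (hY.contDiffAt (hV.mem_nhds (hK'V (hts (hsub hx)))))).contMDiffAt
  have hcs : HasCompactSupport fun x => f x • Y x :=
    hK'.of_isClosed_subset (isClosed_tsupport _) (hsub.trans hts)
  obtain ⟨L, hL⟩ := hZ.lipschitzWith_of_hasCompactSupport hcs one_ne_zero
  obtain ⟨B, hB⟩ := hcs.exists_bound_of_continuous hZ.continuous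
  refine ⟨_, L, B.toNNReal, hL, fun x => (hB x).trans (Real.le_coe_toNNReal B), fun x hx => ?_⟩
  simp [hf1.self_of_nhdsSet x hx]

/-- A bounded Lipschitz vector field has global forward solutions. -/
theorem exists_forall_hasDerivWithinAt_Ici {E : Type*} [NormedAddCommGroup E] [NormedSpace ℝ E]
    [CompleteSpace E] {Z : E → E} {L B : NNReal} (hL : LipschitzWith L Z)
    (hB : ∀ x, ‖Z x‖ ≤ B) (x₀ : E) :
    ∃ x : ℝ → E, x 0 = x₀ ∧ ∀ t : ℝ, 0 ≤ t → HasDerivWithinAt x (Z (x t)) (Ici 0) t := by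
  have key : ∀ n : ℕ, ∃ x : ℝ → E, x 0 = x₀ ∧
      ∀ t ∈ Icc (0 : ℝ) n, HasDerivWithinAt x (Z (x t)) (Icc 0 n) t := fun n => by
    have hm : (B : ℝ) * max ((n : ℝ) - ((⟨0, by simp⟩ : Icc (0 : ℝ) n) : ℝ))
        (((⟨0, by simp⟩ : Icc (0 : ℝ) n) : ℝ) - 0) ≤ ((B * n : NNReal) : ℝ) - ((0 : NNReal) : ℝ) := by
      simp
    exact (IsPicardLindelof.of_time_independent (x₀ := x₀) (fun x _ => hB x) hL.lipschitzOnWith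
      hm).exists_eq_forall_mem_Icc_hasDerivWithinAt₀
  choose f hf0 hf using key
  have hIci : ∀ (n : ℕ) (t : ℝ), t ∈ Ico (0 : ℝ) n →
      HasDerivWithinAt (f n) (Z (f n t)) (Ici 0) t := fun n t ht =>
    (hf n t (Ico_subset_Icc_self ht)).mono_of_mem_nhdsWithin (by
      rw [← Ici_inter_Iic]
      exact inter_mem_nhdsWithin _ (Iic_mem_nhds ht.2))
  have hcont : ∀ n, ContinuousOn (f n) (Icc 0 n) := fun n t ht => (hf n t ht).continuousWithinAt
  have heq : ∀ (m n : ℕ) (t : ℝ), 0 ≤ t → t ≤ m → m ≤ n → f m t = f n t := by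
    intro m n t h0 ht hmn
    have hmn' : (m : ℝ) ≤ n := by exact_mod_cast hmn
    refine ODE_solution_unique (v := fun _ => Z) (fun _ => hL) (hcont m)
      (fun s hs => (hIci m s hs).mono (Ici_subset_Ici.2 hs.1))
      ((hcont n).mono (Icc_subset_Icc_right hmn'))
      (fun s hs => (hIci n s ⟨hs.1, hs.2.trans_le hmn'⟩).mono (Ici_subset_Ici.2 hs.1))
      ((hf0 m).trans (hf0 n).symm) ⟨h0, ht⟩
  refine ⟨fun t => f (⌊t⌋₊ + 1) t, hf0 _, fun t ht => ?_⟩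
  have hlt : t < ((⌊t⌋₊ + 1 : ℕ) : ℝ) := by exact_mod_cast Nat.lt_floor_add_one t
  refine (hIci (⌊t⌋₊ + 1) t ⟨ht, hlt⟩).congr_of_eventuallyEq ?_ rfl
  filter_upwards [self_mem_nhdsWithin, mem_nhdsWithin_of_mem_nhds (Iio_mem_nhds hlt)] with s hs hs'
  refine heq _ _ s hs (by exact_mod_cast (Nat.lt_floor_add_one s).le) ?_
  have : ⌊s⌋₊ < ⌊t⌋₊ + 1 := (Nat.floor_lt hs).2 hs'
  omega

theorem abs_le_exp_mul_of_hasDerivWithinAt {f β : ℝ → ℝ} {a b : ℝ}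
    (hf : ∀ t ∈ Icc 0 b, HasDerivWithinAt f (-(β t * f t)) (Ici 0) t)
    (hβ : ∀ t ∈ Icc 0 b, a ≤ β t) (hb : 0 ≤ b) :
    |f b| ≤ Real.exp (-a * b) * |f 0| := by
  have hg : ∀ t ∈ Icc 0 b, HasDerivWithinAt (fun t => (Real.exp (a * t) * f t) ^ 2)
      (-(2 * (β t - a) * (Real.exp (a * t) * f t) ^ 2)) (Ici 0) t := fun t ht => by
    have h1 : HasDerivWithinAt (fun t => Real.exp (a * t)) (Real.exp (a * t) * a) (Ici 0) t := by
      simpa using (((hasDerivAt_id t).const_mul a).exp).hasDerivWithinAt (s := Ici 0)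
    convert! (h1.mul (hf t ht)).pow 2 using 1
    simp
    ring
  have hanti : AntitoneOn (fun t => (Real.exp (a * t) * f t) ^ 2) (Icc 0 b) := by
    refine antitoneOn_of_hasDerivWithinAt_nonpos (convex_Icc 0 b)
      (fun t ht => (hg t ht).continuousWithinAt.mono Icc_subset_Ici_self)
      (fun t ht => (hg t (interior_subset ht)).mono
        (interior_subset.trans Icc_subset_Ici_self)) (fun t ht => ?_)
    have := hβ t (interior_subset ht)
    have h2 : 0 ≤ β t - a := by linarith
    simp only [Left.neg_nonpos_iff]
    positivity
  have h1 := hanti (left_mem_Icc.2 hb) (right_mem_Icc.2 hb) hb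
  have h2 := sq_le_sq.1 h1
  simp only [mul_zero, Real.exp_zero, one_mul, abs_mul, Real.abs_exp] at h2
  calc |f b| = Real.exp (-a * b) * (Real.exp (a * b) * |f b|) := by
        rw [← mul_assoc, ← Real.exp_add]; simp
    _ ≤ _ := by gcongr

/-- A continuous function that drops to at most `η' < η` as long as it has stayed below `η` never
reaches `η`. -/
theorem forall_lt_of_continuousOn_of_gap {f : ℝ → ℝ} {η η' : ℝ} (hη : η' < η)
    (hf : ContinuousOn f (Ici 0)) (h0 : f 0 < η)
    (hgap : ∀ t ≥ 0, (∀ s ∈ Icc 0 t, f s < η) → f t ≤ η') : ∀ t ≥ 0, f t < η := by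
  by_contra! hcon
  obtain ⟨b, hb, hfb⟩ := hcon
  set A := Icc 0 b ∩ f ⁻¹' Ici η with hA
  have hAc : IsCompact A := isCompact_Icc.of_isClosed_subset
    ((hf.mono Icc_subset_Ici_self).preimage_isClosed_of_isClosed isClosed_Icc isClosed_Ici)
    inter_subset_left
  obtain ⟨m, hm, hmin⟩ := hAc.exists_isLeast ⟨b, ⟨hb, le_rfl⟩, hfb⟩
  have hlt : ∀ s ∈ Ico 0 m, f s < η := fun s hs => by
    by_contra! hcon
    exact absurd (hmin ⟨⟨hs.1, hs.2.le.trans hm.1.2⟩, hcon⟩) (not_le.2 hs.2)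
  have hm0 : 0 < m := hm.1.1.lt_of_ne fun h => absurd (h ▸ hm.2) (not_le.2 h0)
  have hle : f m ≤ η' := by
    have hcl : m ∈ closure (Ico 0 m) := by
      rw [closure_Ico hm0.ne]; exact right_mem_Icc.2 hm0.le
    have : (𝓝[Ico 0 m] m).NeBot := mem_closure_iff_nhdsWithin_neBot.1 hcl
    refine le_of_tendsto ((hf m hm0.le).mono (fun _ h => h.1) : Tendsto f (𝓝[Ico 0 m] m) _) ?_
    filter_upwards [self_mem_nhdsWithin] with s hs
    exact hgap s hs.1 fun r hr => hlt r ⟨hr.1, hr.2.trans_lt hs.2⟩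
  exact absurd (mem_preimage.1 hm.2) (not_le.2 (hle.trans_lt hη))

/-- A map with injective strict derivative is locally antilipschitz. -/
theorem HasStrictFDerivAt.exists_norm_sub_le_of_injective {E G : Type*} [NormedAddCommGroup E]
    [NormedSpace ℝ E] [FiniteDimensional ℝ E] [NormedAddCommGroup G] [NormedSpace ℝ G]
    {F : E → G} {A : E →L[ℝ] G} {p : E} (hF : HasStrictFDerivAt F A p)
    (hA : Function.Injective A) :
    ∃ K > 0, ∀ᶠ q : E × E in 𝓝 (p, p), ‖q.1 - q.2‖ ≤ K * ‖F q.1 - F q.2‖ := by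
  obtain ⟨k, hk, hkA⟩ := (A : E →ₗ[ℝ] G).exists_antilipschitzWith (LinearMap.ker_eq_bot.2 hA)
  have hk' : (0 : ℝ) < k := hk
  refine ⟨2 * k, by positivity, ?_⟩
  filter_upwards [hF.isLittleO.def (show 0 < (2 * (k : ℝ))⁻¹ by positivity)] with q hq
  have h1 : ‖q.1 - q.2‖ ≤ k * ‖A (q.1 - q.2)‖ := by
    simpa [dist_eq_norm] using hkA.le_mul_dist (q.1 - q.2) 0
  have h2 : ‖A (q.1 - q.2)‖ ≤ ‖F q.1 - F q.2‖ + (2 * (k : ℝ))⁻¹ * ‖q.1 - q.2‖ := by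
    have := norm_sub_norm_le (A (q.1 - q.2)) (F q.1 - F q.2)
    rw [norm_sub_rev (A _)] at this
    linarith
  have h3 : (k : ℝ) * ((2 * (k : ℝ))⁻¹ * ‖q.1 - q.2‖) = ‖q.1 - q.2‖ / 2 := by field_simp
  nlinarith [mul_le_mul_of_nonneg_left h2 hk'.le]

/-- Near a point of a regular curve contained in a level set of `F`, a phase `p.1` approximating the
point `p.2` can be corrected so that the remaining error is controlled by `F` alone. -/
theorem exists_eventually_phase_correction {E G : Type*} [NormedAddCommGroup E]
    [InnerProductSpace ℝ E] [FiniteDimensional ℝ E] [NormedAddCommGroup G] [NormedSpace ℝ G]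
    {F : E → G} {A : E →L[ℝ] G} {γ : ℝ → E} {w : E} {s₀ : ℝ} {g : G}
    (hF : HasStrictFDerivAt F A (γ s₀)) (hγ : HasStrictDerivAt γ w s₀) (hw : w ≠ 0)
    (hker : ∀ v, A v = 0 → ⟪w, v⟫ = 0 → v = 0) (hFγ : ∀ s, F (γ s) = g) :
    ∃ K > 0, ∀ᶠ p : ℝ × E in 𝓝 (s₀, γ s₀), ∃ s' : ℝ,
      |s' - p.1| ≤ K * dist p.2 (γ p.1) ∧ dist p.2 (γ s') ≤ K * ‖F p.2 - g‖ := by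
  have hinj : Function.Injective (A.prod (innerSL ℝ w)) := by
    refine (injective_iff_map_eq_zero _).2 fun v hv => ?_
    rw [ContinuousLinearMap.prod_apply, Prod.mk_eq_zero] at hv
    exact hker v hv.1 (by simpa using hv.2)
  obtain ⟨K₁, hK₁, h₁⟩ := HasStrictFDerivAt.exists_norm_sub_le_of_injective
    (hF.prodMk ((innerSL ℝ w).hasStrictFDerivAt)) hinj
  set f : ℝ → ℝ := fun s => ⟪w, γ s⟫ with hf_def
  have hf : HasStrictDerivAt f ⟪w, w⟫ s₀ :=
    (innerSL ℝ w).hasStrictFDerivAt.comp_hasStrictDerivAt s₀ hγ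
  have hw' : ⟪w, w⟫ ≠ 0 := inner_self_ne_zero.2 hw
  set φ : ℝ → ℝ := hf.localInverse f _ s₀ hw' with hφ_def
  have hφ : HasStrictDerivAt φ ⟪w, w⟫⁻¹ (f s₀) := hf.to_localInverse hw'
  have hleft : ∀ᶠ s in 𝓝 s₀, φ (f s) = s :=
    (hf.hasStrictFDerivAt_equiv hw').eventually_left_inverse
  have hright : ∀ᶠ y in 𝓝 (f s₀), f (φ y) = y :=
    (hf.hasStrictFDerivAt_equiv hw').eventually_right_inverse
  obtain ⟨k, N, hN, hk⟩ := hφ.hasStrictFDerivAt.exists_lipschitzOnWith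
  have hinner : Tendsto (fun p : ℝ × E => ⟪w, p.2⟫) (𝓝 (s₀, γ s₀)) (𝓝 (f s₀)) :=
    (Continuous.tendsto (by fun_prop) _ : Tendsto (fun p : ℝ × E => ⟪w, p.2⟫) _ _)
  have hfst : Tendsto (fun p : ℝ × E => f p.1) (𝓝 (s₀, γ s₀)) (𝓝 (f s₀)) :=
    hf.hasDerivAt.continuousAt.tendsto.comp continuous_fst.continuousAt
  have hpt : Tendsto (fun p : ℝ × E => γ (φ ⟪w, p.2⟫)) (𝓝 (s₀, γ s₀)) (𝓝 (γ s₀)) := by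
    have h2 : Tendsto φ (𝓝 (f s₀)) (𝓝 s₀) := by
      have := hφ.hasDerivAt.continuousAt.tendsto
      rwa [hleft.self_of_nhds] at this
    exact hγ.hasDerivAt.continuousAt.tendsto.comp (h2.comp hinner)
  have hpair : Tendsto (fun p : ℝ × E => (p.2, γ (φ ⟪w, p.2⟫))) (𝓝 (s₀, γ s₀))
      (𝓝 (γ s₀, γ s₀)) := by
    rw [nhds_prod_eq (x := γ s₀)]
    exact (continuous_snd.tendsto _).prodMk hpt
  refine ⟨max K₁ (k * ‖w‖), lt_max_of_lt_left hK₁, ?_⟩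
  filter_upwards [hpair.eventually h₁, hinner.eventually hright, hinner.eventually hN,
    hfst.eventually hN, (continuous_fst.tendsto (s₀, γ s₀)).eventually hleft] with p hp hr hN1 hN2 hl
  refine ⟨φ ⟪w, p.2⟫, ?_, ?_⟩
  · have h3 := hk.dist_le_mul _ hN1 _ hN2
    rw [hl, Real.dist_eq, Real.dist_eq] at h3
    have h4 : |⟪w, p.2⟫ - f p.1| ≤ ‖w‖ * dist p.2 (γ p.1) := by
      rw [hf_def, ← inner_sub_right, dist_eq_norm]
      exact abs_real_inner_le_norm _ _
    calc _ ≤ (k : ℝ) * |⟪w, p.2⟫ - f p.1| := h3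
      _ ≤ k * (‖w‖ * dist p.2 (γ p.1)) := by gcongr
      _ = (k * ‖w‖) * dist p.2 (γ p.1) := by ring
      _ ≤ _ := by gcongr; exact le_max_right _ _
  · have h5 : ⟪w, γ (φ ⟪w, p.2⟫)⟫ = ⟪w, p.2⟫ := hr
    have h6 : ‖(F p.2, ⟪w, p.2⟫) - (F (γ (φ ⟪w, p.2⟫)), ⟪w, γ (φ ⟪w, p.2⟫)⟫)‖ = ‖F p.2 - g‖ := by
      rw [h5, hFγ, Prod.mk_sub_mk, sub_self, Prod.norm_mk]
      simp
    rw [dist_eq_norm]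
    calc _ ≤ K₁ * _ := hp
      _ = K₁ * ‖F p.2 - g‖ := by rw [← h6]; rfl
      _ ≤ _ := by gcongr; exact le_max_left _ _

/-- Uniform version of `exists_eventually_phase_correction` along a periodic curve. -/
theorem exists_phase_correction {E G : Type*} [NormedAddCommGroup E]
    [InnerProductSpace ℝ E] [FiniteDimensional ℝ E] [NormedAddCommGroup G] [NormedSpace ℝ G]
    {F : E → G} {A : ℝ → E →L[ℝ] G} {γ w : ℝ → E} {g : G} {T : ℝ} (hT : 0 < T)
    (hF : ∀ s, HasStrictFDerivAt F (A s) (γ s)) (hγ : ∀ s, HasStrictDerivAt γ (w s) s)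
    (hw : ∀ s, w s ≠ 0) (hker : ∀ s v, A s v = 0 → ⟪w s, v⟫ = 0 → v = 0)
    (hFγ : ∀ s, F (γ s) = g) (hper : Function.Periodic γ T) :
    ∃ K > 0, ∀ s x, dist x (γ s) < 1 / K → ∃ s' : ℝ,
      |s' - s| ≤ K * dist x (γ s) ∧ dist x (γ s') ≤ K * ‖F x - g‖ := by
  have hmono : ∀ {K K' s : ℝ} {x : E}, 0 < K → K ≤ K' → dist x (γ s) < 1 / K' →
      (dist x (γ s) < 1 / K → ∃ s' : ℝ,
        |s' - s| ≤ K * dist x (γ s) ∧ dist x (γ s') ≤ K * ‖F x - g‖) →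
      ∃ s' : ℝ, |s' - s| ≤ K' * dist x (γ s) ∧ dist x (γ s') ≤ K' * ‖F x - g‖ := by
    intro K K' s x hK hKK' hd h
    obtain ⟨s', h1, h2⟩ := h (hd.trans_le (one_div_le_one_div_of_le hK hKK'))
    exact ⟨s', h1.trans (by gcongr), h2.trans (by gcongr)⟩
  obtain ⟨K, hK, h⟩ : ∃ K > 0, ∀ s ∈ Icc 0 T, ∀ x, dist x (γ s) < 1 / K → ∃ s' : ℝ,
      |s' - s| ≤ K * dist x (γ s) ∧ dist x (γ s') ≤ K * ‖F x - g‖ := by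
    refine isCompact_Icc.induction_on (p := fun S => ∃ K > 0, ∀ s ∈ S, ∀ x,
      dist x (γ s) < 1 / K → ∃ s' : ℝ,
        |s' - s| ≤ K * dist x (γ s) ∧ dist x (γ s') ≤ K * ‖F x - g‖)
      ⟨1, one_pos, by simp⟩ (fun S S' hS ⟨K, hK, h⟩ => ⟨K, hK, fun s hs => h s (hS hs)⟩) ?_ ?_
    · rintro S S' ⟨K, hK, h⟩ ⟨K', hK', h'⟩
      refine ⟨max K K', lt_max_of_lt_left hK, fun s hs x hx => ?_⟩
      rcases hs with hs | hs
      · exact hmono hK (le_max_left _ _) hx (h s hs x)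
      · exact hmono hK' (le_max_right _ _) hx (h' s hs x)
    · intro s₀ _
      obtain ⟨K, hK, h⟩ := exists_eventually_phase_correction (hF s₀) (hγ s₀) (hw s₀) (hker s₀) hFγ
      rw [nhds_prod_eq] at h
      obtain ⟨P, hP, Q, hQ, h⟩ := eventually_prod_iff.1 h
      obtain ⟨r, hr, hrQ⟩ := Metric.eventually_nhds_iff.1 hQ
      have hclose : ∀ᶠ s in 𝓝 s₀, dist (γ s) (γ s₀) < r / 2 :=
        Metric.tendsto_nhds.1 (hγ s₀).hasDerivAt.continuousAt _ (half_pos hr)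
      refine ⟨_, mem_nhdsWithin_of_mem_nhds (hP.and hclose), max K (2 / r),
        lt_max_of_lt_left hK, fun s hs x hx => hmono hK (le_max_left _ _) hx fun _ => ?_⟩
      refine h hs.1 (hrQ ?_)
      have h1 : 1 / max K (2 / r) ≤ r / 2 := by
        rw [← one_div_div 2 r]
        exact one_div_le_one_div_of_le (div_pos two_pos hr) (le_max_right _ _)
      linarith [dist_triangle x (γ s) (γ s₀), hs.2]
  refine ⟨K, hK, fun s x hx => ?_⟩
  obtain ⟨n, hn, -⟩ := existsUnique_sub_zsmul_mem_Ico hT s 0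
  have hγn : ∀ r, γ (r - n • T) = γ r := fun r => by simpa using hper.sub_zsmul_eq n (x := r)
  obtain ⟨s', h1, h2⟩ := h (s - n • T) ⟨hn.1, by simpa using hn.2.le⟩ x (by rwa [hγn])
  refine ⟨s' + n • T, ?_, ?_⟩
  · rw [hγn] at h1
    convert h1 using 2
    ring
  · rwa [← hγn (s' + n • T), add_sub_cancel_right]

/-- A solution whose distance to an orbit decays exponentially, after phase corrections of the size
of the distance, has an asymptotic phase. -/
theorem exists_asymptotic_phase {E : Type*} [NormedAddCommGroup E] [NormedSpace ℝ E]
    {Z : E → E} {L B : NNReal} {γ x : ℝ → E} {K D a η : ℝ} (hZ : LipschitzWith L Z)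
    (hγ : ∀ t, HasDerivAt γ (Z (γ t)) t) (hγB : LipschitzWith B γ)
    (hx : ∀ t : ℝ, 0 ≤ t → HasDerivWithinAt x (Z (x t)) (Ici 0) t) (ha : 0 < a) (hK : 0 ≤ K)
    (hcorr : ∀ t ≥ 0, ∀ s, dist (x t) (γ s) < η → ∃ s' : ℝ,
      |s' - s| ≤ K * dist (x t) (γ s) ∧ dist (x t) (γ s') ≤ D * Real.exp (-a * t))
    (hD : D * Real.exp L < η) (h0 : ∃ s, dist (x 0) (γ s) < η) :
    ∃ θ₀ : ℝ, Tendsto (fun t => dist (x t) (γ (t + θ₀))) atTop (𝓝 0) := by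
  have hD0 : 0 ≤ D := by
    obtain ⟨s, hs⟩ := h0
    obtain ⟨s', -, h⟩ := hcorr 0 le_rfl s hs
    simpa using dist_nonneg.trans h
  set r := Real.exp (-a) with hr
  have hr0 : 0 < r := Real.exp_pos _
  have hr1 : r < 1 := Real.exp_lt_one_iff.2 (by linarith)
  have hrn : ∀ n : ℕ, Real.exp (-a * n) = r ^ n := fun n => by rw [hr, ← Real.exp_nat_mul, mul_comm]
  have hgron : ∀ (n : ℕ) (θ : ℝ), dist (x n) (γ (n + θ)) ≤ D * r ^ n →
      ∀ t ∈ Icc (n : ℝ) (n + 1), dist (x t) (γ (t + θ)) ≤ D * Real.exp L * r ^ n := by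
    intro n θ hn t ht
    have hn0 : (0 : ℝ) ≤ n := n.cast_nonneg
    have h1 := dist_le_of_trajectories_ODE (v := fun _ => Z) (f := x) (g := fun t => γ (t + θ))
      (fun _ => hZ) (fun s hs => (hx s (hn0.trans hs.1)).continuousWithinAt.mono
        fun u hu => hn0.trans hu.1)
      (fun s hs => (hx s (hn0.trans hs.1)).mono (Ici_subset_Ici.2 (hn0.trans hs.1)))
      (fun s _ => ((hγ (s + θ)).comp_add_const s θ).continuousAt.continuousWithinAt)
      (fun s _ => ((hγ (s + θ)).comp_add_const s θ).hasDerivWithinAt) hn t ht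
    refine h1.trans ?_
    rw [mul_right_comm]
    gcongr
    have : t - n ≤ 1 := by linarith [ht.2]
    nlinarith [L.coe_nonneg]
  have hstep : ∀ (n : ℕ) (θ : ℝ), ∃ θ', dist (x n) (γ (n + θ)) ≤ D * r ^ n →
      dist (x (n + 1 : ℕ)) (γ ((n + 1 : ℕ) + θ')) ≤ D * r ^ (n + 1) ∧
        |θ' - θ| ≤ K * (D * Real.exp L) * r ^ n := by
    intro n θ
    by_cases hn : dist (x n) (γ (n + θ)) ≤ D * r ^ n
    · have h1 := hgron n θ hn (n + 1 : ℕ) ⟨by simp, by simp⟩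
      have h2 : D * Real.exp L * r ^ n ≤ D * Real.exp L :=
        mul_le_of_le_one_right (by positivity) (pow_le_one₀ hr0.le hr1.le)
      obtain ⟨s', h3, h4⟩ := hcorr (n + 1 : ℕ) (Nat.cast_nonneg _) _ ((h1.trans h2).trans_lt hD)
      refine ⟨s' - (n + 1 : ℕ), fun _ => ⟨?_, ?_⟩⟩
      · rw [add_sub_cancel, ← hrn]
        exact h4
      · rw [sub_sub]
        refine h3.trans ?_
        rw [mul_assoc]
        gcongr
    · exact ⟨θ, fun h => absurd h hn⟩
  choose next hnext using hstep
  obtain ⟨s, hs⟩ := h0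
  obtain ⟨s₀, -, hs₀⟩ := hcorr 0 le_rfl s hs
  set θ : ℕ → ℝ := fun n => Nat.rec s₀ next n with hθ
  have hclose : ∀ n : ℕ, dist (x n) (γ (n + θ n)) ≤ D * r ^ n := by
    intro n
    induction n with
    | zero => simpa [hθ] using hs₀
    | succ n ih => exact (hnext n _ ih).1
  have hgeom : ∀ n, dist (θ n) (θ (n + 1)) ≤ K * (D * Real.exp L) * r ^ n := fun n => by
    rw [dist_comm, Real.dist_eq]
    exact (hnext n _ (hclose n)).2
  obtain ⟨θ₀, hθ₀⟩ := cauchySeq_tendsto_of_complete (cauchySeq_of_le_geometric _ _ hr1 hgeom)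
  refine ⟨θ₀, ?_⟩
  have hbound : Tendsto (fun t : ℝ => D * Real.exp L * r ^ ⌊t⌋₊ + B * dist (θ ⌊t⌋₊) θ₀)
      atTop (𝓝 0) := by
    have h1 : Tendsto (fun n : ℕ => D * Real.exp L * r ^ n + B * dist (θ n) θ₀) atTop (𝓝 0) := by
      simpa using ((tendsto_pow_atTop_nhds_zero_of_lt_one hr0.le hr1).const_mul
        (D * Real.exp L)).add ((tendsto_iff_dist_tendsto_zero.1 hθ₀).const_mul (B : ℝ))
    exact h1.comp tendsto_nat_floor_atTop
  refine squeeze_zero' (Eventually.of_forall fun _ => dist_nonneg) ?_ hbound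
  filter_upwards [eventually_ge_atTop 0] with t ht
  refine (dist_triangle _ (γ (t + θ ⌊t⌋₊)) _).trans (add_le_add ?_ ?_)
  · exact hgron _ _ (hclose _) t ⟨Nat.floor_le ht, (Nat.lt_floor_add_one t).le⟩
  · simpa using hγB.dist_le_mul (t + θ ⌊t⌋₊) (t + θ₀)

/-- Solutions starting close to `Γ` on a level set of the first integral `C` stay close to `Γ`, and
`H - h` decays exponentially along them. -/
theorem tube_estimates {E : Type*} [NormedAddCommGroup E] [NormedSpace ℝ E] {H C β : E → ℝ}
    {Y : E → E} {Γ : Set E} {x : ℝ → E} {η a K h c : ℝ} (ha : 0 ≤ a) (hK : 0 ≤ K)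
    (hH : ∀ u, Metric.infDist u Γ < η → DifferentiableAt ℝ H u)
    (hC : ∀ u, Metric.infDist u Γ < η → DifferentiableAt ℝ C u)
    (hHY : ∀ u, Metric.infDist u Γ < η → fderiv ℝ H u (Y u) = -(β u * (H u - h)))
    (hCY : ∀ u, Metric.infDist u Γ < η → fderiv ℝ C u (Y u) = 0)
    (hβ : ∀ u, Metric.infDist u Γ < η → a ≤ β u)
    (hdist : ∀ u, Metric.infDist u Γ < η → C u = c → Metric.infDist u Γ ≤ K * |H u - h|)
    (hxc : ContinuousOn x (Ici 0))
    (hx : ∀ t ≥ 0, Metric.infDist (x t) Γ < η → HasDerivWithinAt x (Y (x t)) (Ici 0) t)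
    (h0 : Metric.infDist (x 0) Γ < η) (hC0 : C (x 0) = c) (hH0 : K * |H (x 0) - h| < η) :
    ∀ t ≥ 0, Metric.infDist (x t) Γ < η ∧ C (x t) = c ∧
      |H (x t) - h| ≤ Real.exp (-a * t) * |H (x 0) - h| ∧
      Metric.infDist (x t) Γ ≤ K * |H (x t) - h| := by
  have main : ∀ t ≥ 0, (∀ s ∈ Icc 0 t, Metric.infDist (x s) Γ < η) → C (x t) = c ∧
      |H (x t) - h| ≤ Real.exp (-a * t) * |H (x 0) - h| ∧
      Metric.infDist (x t) Γ ≤ K * |H (x t) - h| := by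
    intro t ht hs
    have hCd : ∀ s ∈ Icc 0 t, HasDerivWithinAt (C ∘ x) 0 (Ici 0) s := fun s hst => by
      simpa only [hCY _ (hs s hst)] using
        (hC _ (hs s hst)).hasFDerivAt.comp_hasDerivWithinAt s (hx s hst.1 (hs s hst))
    have hCt : C (x t) = c := by
      rw [← hC0]
      exact constant_of_has_deriv_right_zero
        (fun s hst => (hCd s hst).continuousWithinAt.mono Icc_subset_Ici_self)
        (fun s hst => (hCd s (Ico_subset_Icc_self hst)).mono (Ici_subset_Ici.2 hst.1)) t
        (right_mem_Icc.2 ht)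
    refine ⟨hCt, ?_, hdist _ (hs t (right_mem_Icc.2 ht)) hCt⟩
    refine abs_le_exp_mul_of_hasDerivWithinAt (f := fun s => H (x s) - h)
      (β := fun s => β (x s)) (fun s hst => ?_) (fun s hst => hβ _ (hs s hst)) ht
    rw [← hHY _ (hs s hst)]
    exact ((hH _ (hs s hst)).hasFDerivAt.comp_hasDerivWithinAt s
      (hx s hst.1 (hs s hst))).sub_const h
  have htube : ∀ t ≥ 0, Metric.infDist (x t) Γ < η := by
    refine forall_lt_of_continuousOn_of_gap hH0
      ((Metric.continuous_infDist_pt Γ).comp_continuousOn hxc) h0 fun t ht hs => ?_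
    obtain ⟨-, h1, h2⟩ := main t ht hs
    refine h2.trans (mul_le_mul_of_nonneg_left ?_ hK)
    refine h1.trans (mul_le_of_le_one_left (abs_nonneg _) (Real.exp_le_one_iff.2 ?_))
    nlinarith
  exact fun t ht => ⟨htube t ht, main t ht fun s hs => htube s hs.1⟩

theorem cross3_eq (a b : E3) : cross3 a b =
    !₂[a 1 * b 2 - a 2 * b 1, a 2 * b 0 - a 0 * b 2, a 0 * b 1 - a 1 * b 0] := by
  simp [cross3, cross_apply]

theorem inner_E3 (a b : E3) : ⟪a, b⟫ = a 0 * b 0 + a 1 * b 1 + a 2 * b 2 := by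
  simp [PiLp.inner_apply, Fin.sum_univ_three, mul_comm]

theorem inner_self_cross3 (a b : E3) : ⟪a, cross3 a b⟫ = 0 := by
  simp [inner_E3, cross3_eq]; ring

theorem inner_cross3_self (a b : E3) : ⟪b, cross3 a b⟫ = 0 := by
  simp [inner_E3, cross3_eq]; ring

theorem inner_cross3_cross3 (a b : E3) : ⟪a, cross3 b (cross3 a b)⟫ = ‖cross3 a b‖ ^ 2 := by
  rw [← real_inner_self_eq_norm_sq, inner_E3, inner_E3]
  simp [cross3_eq]; ring

theorem cross3_ne_zero {a b : E3} (hab : LinearIndependent ℝ ![a, b]) : cross3 a b ≠ 0 := by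
  have h : LinearIndependent ℝ ![WithLp.linearEquiv 2 ℝ (Fin 3 → ℝ) a,
      WithLp.linearEquiv 2 ℝ (Fin 3 → ℝ) b] := by
    have := hab.map' (WithLp.linearEquiv 2 ℝ (Fin 3 → ℝ)).toLinearMap (LinearEquiv.ker _)
    convert! this using 1
    ext i : 1
    fin_cases i <;> rfl
  intro h0
  refine crossProduct_ne_zero_iff_linearIndependent.2 h ?_
  exact (WithLp.equiv 2 (Fin 3 → ℝ)).symm.injective h0

theorem eq_zero_of_inner_cross3 {a b v : E3} (hab : LinearIndependent ℝ ![a, b])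
    (ha : ⟪a, v⟫ = 0) (hb : ⟪b, v⟫ = 0) (hc : ⟪cross3 a b, v⟫ = 0) : v = 0 := by
  set n := cross3 a b with hn
  have hn0 : ‖n‖ ^ 2 ≠ 0 := by simpa using cross3_ne_zero hab
  have key : ‖n‖ ^ 2 • v = ⟪a, v⟫ • cross3 b n + ⟪b, v⟫ • cross3 n a + ⟪n, v⟫ • n := by
    rw [← real_inner_self_eq_norm_sq, inner_E3, inner_E3, inner_E3, inner_E3]
    ext i
    fin_cases i <;> simp [hn, cross3_eq] <;> ring
  rw [ha, hb, hc] at key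
  simpa [hn0] using key

theorem ContDiffOn.cross3 {E : Type*} [NormedAddCommGroup E] [NormedSpace ℝ E] {f g : E → E3}
    {s : Set E} {n : WithTop ℕ∞} (hf : ContDiffOn ℝ n f s) (hg : ContDiffOn ℝ n g s) :
    ContDiffOn ℝ n (fun x => cross3 (f x) (g x)) s := by
  rw [contDiffOn_euclidean] at hf hg ⊢
  intro i
  have := fun i j => (hf i).mul (hg j)
  fin_cases i <;> simp only [cross3_eq]
  · exact (this 1 2).sub (this 2 1)
  · exact (this 2 0).sub (this 0 2)
  · exact (this 0 1).sub (this 1 0)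

theorem ContDiffOn.gradient_of_isOpen {E : Type*} [NormedAddCommGroup E] [InnerProductSpace ℝ E]
    [CompleteSpace E] {f : E → ℝ} {s : Set E} {m n : WithTop ℕ∞} (hf : ContDiffOn ℝ n f s)
    (hs : IsOpen s) (hmn : m + 1 ≤ n) : ContDiffOn ℝ m (gradient f) s :=
  (InnerProductSpace.toDual ℝ E).symm.contDiff.comp_contDiffOn (hf.fderiv_of_isOpen hs hmn)

theorem inner_gradient {E : Type*} [NormedAddCommGroup E] [InnerProductSpace ℝ E]
    [CompleteSpace E] (f : E → ℝ) (x v : E) : ⟪gradient f x, v⟫ = fderiv ℝ f x v :=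
  InnerProductSpace.toDual_symm_apply

/-- If moreover `c` is a regular value of `C`, then for every smooth
`α : V → (0,∞)`, `Γ` is a periodic orbit of the perturbed system
`v' = X(v) − α(v)(H(v)−h)[∇C(v) × (∇H(v) × ∇C(v))]` and is orbitally phase
asymptotically stable with respect to perturbations in `C⁻¹({c}) ∩ V`. -/
theorem stmt_8
    (U : Set E3) (hU : IsOpen U) (ν H C : E3 → ℝ)
    (hν : ContDiffOn ℝ (⊤ : ℕ∞) ν U) (hH : ContDiffOn ℝ (⊤ : ℕ∞) H U)
    (hC : ContDiffOn ℝ (⊤ : ℕ∞) C U)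
    (X : E3 → E3) (hX : ∀ u, X u = ν u • cross3 (gradient H u) (gradient C u))
    (V : Set E3) (hV : IsOpen V) (hVU : V ⊆ U)
    (hind : ∀ u ∈ V, LinearIndependent ℝ ![gradient H u, gradient C u])
    (γ : ℝ → E3) (T : ℝ) (hT : 0 < T)
    (hγV : ∀ t, γ t ∈ V)
    (hsol : ∀ t, HasDerivAt γ (X (γ t)) t)
    (hper : ∀ t, γ (t + T) = γ t)
    (hnonconst : ∃ s t, γ s ≠ γ t)
    (Γ : Set E3) (hΓ : Γ = γ '' Set.Icc 0 T)
    (h c : ℝ) (hHγ : ∀ t, H (γ t) = h) (hCγ : ∀ t, C (γ t) = c)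
    (hreg : ∀ u ∈ U, H u = h → C u = c →
      LinearIndependent ℝ ![gradient H u, gradient C u])
    (hregC : ∀ u ∈ U, C u = c → gradient C u ≠ 0)
    (α : E3 → ℝ) (hα : ContDiffOn ℝ (⊤ : ℕ∞) α V) (hαpos : ∀ u ∈ V, 0 < α u)
    (Y : E3 → E3)
    (hY : ∀ u, Y u = X u
      - (α u * (H u - h)) • cross3 (gradient C u) (cross3 (gradient H u) (gradient C u))) :
    (∀ t, HasDerivAt γ (Y (γ t)) t) ∧
      OrbitallyPhaseAsymptoticallyStable Y V (C ⁻¹' {c} ∩ V) γ Γ := by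
  have hYX : ∀ t, Y (γ t) = X (γ t) := fun t => by simp [hY, hHγ]
  have hγY : ∀ t, HasDerivAt γ (Y (γ t)) t := fun t => hYX t ▸ hsol t
  refine ⟨hγY, ?_⟩
  have hΓr : Γ = range γ := by
    rw [hΓ]; simpa using Function.Periodic.image_Icc hper hT 0
  have hγΓ : ∀ t, γ t ∈ Γ := fun t => hΓr ▸ mem_range_self t
  have hne : Γ.Nonempty := ⟨γ 0, hγΓ 0⟩
  have hγc : Continuous γ := continuous_iff_continuousAt.2 fun t => (hsol t).continuousAt
  have hΓc : IsCompact Γ := hΓ ▸ isCompact_Icc.image hγc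
  have hΓV : Γ ⊆ V := hΓr ▸ range_subset_iff.2 hγV
  have hHV := hH.mono hVU
  have hCV := hC.mono hVU
  have hgH : ContDiffOn ℝ 1 (gradient H) V := hHV.gradient_of_isOpen hV (by norm_cast)
  have hgC : ContDiffOn ℝ 1 (gradient C) V := hCV.gradient_of_isOpen hV (by norm_cast)
  have hH1 : ContDiffOn ℝ 1 H V := hHV.of_le (by norm_cast)
  have hC1 : ContDiffOn ℝ 1 C V := hCV.of_le (by norm_cast)
  have hα1 : ContDiffOn ℝ 1 α V := hα.of_le (by norm_cast)
  have hν1 : ContDiffOn ℝ 1 ν V := (hν.mono hVU).of_le (by norm_cast)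
  have hcr := hgH.cross3 hgC
  have hYV : ContDiffOn ℝ 1 Y V := by
    have : Y = fun u => ν u • cross3 (gradient H u) (gradient C u) - (α u * (H u - h)) •
        cross3 (gradient C u) (cross3 (gradient H u) (gradient C u)) := by
      funext u; rw [hY, hX]
    rw [this]
    exact (hν1.smul hcr).sub ((hα1.mul (hH1.sub contDiffOn_const)).smul (hgC.cross3 hcr))
  set β : E3 → ℝ := fun u => α u * ‖cross3 (gradient H u) (gradient C u)‖ ^ 2 with hβ
  have hHY : ∀ u, fderiv ℝ H u (Y u) = -(β u * (H u - h)) := fun u => by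
    rw [← inner_gradient, hY, hX, inner_sub_right, inner_smul_right, inner_smul_right,
      inner_self_cross3, inner_cross3_cross3, hβ]
    ring
  have hCY : ∀ u, fderiv ℝ C u (Y u) = 0 := fun u => by
    rw [← inner_gradient, hY, hX, inner_sub_right, inner_smul_right, inner_smul_right,
      inner_cross3_self, inner_self_cross3]
    ring
  obtain ⟨ρ, hρ, hρV⟩ := hΓc.exists_cthickening_subset_open hV hΓV
  have hcomp : IsCompact (Metric.cthickening ρ Γ) := hΓc.cthickening
  obtain ⟨a, ha, haβ⟩ : ∃ a > 0, ∀ u ∈ Metric.cthickening ρ Γ, a ≤ β u := by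
    have hβc : ContinuousOn β (Metric.cthickening ρ Γ) :=
      (hα1.continuousOn.mul (hcr.continuousOn.norm.pow 2)).mono hρV
    obtain ⟨u, hu, hmin⟩ := hcomp.exists_isMinOn
      (hne.mono (Metric.self_subset_cthickening Γ)) hβc
    refine ⟨β u, ?_, fun v hv => hmin hv⟩
    have := cross3_ne_zero (hind u (hρV hu))
    have := hαpos u (hρV hu)
    positivity
  obtain ⟨Z, L, B, hZL, hZB, hZY⟩ := exists_lipschitzWith_bounded_eqOn hV hcomp hρV hYV
  have hZΓ : ∀ t, Z (γ t) = X (γ t) := fun t =>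
    (hZY (Metric.self_subset_cthickening Γ (hγΓ t))).trans (hYX t)
  have hγZ : ∀ t, HasDerivAt γ (Z (γ t)) t := fun t => hZΓ t ▸ hsol t
  have hw : ∀ s, Z (γ s) ≠ 0 := fun s hs => by
    have : γ = fun _ => γ s := ODE_solution_unique_univ (v := fun _ => Z) (s := fun _ => univ)
      (t₀ := s) (fun _ => hZL.lipschitzOnWith) (fun t => ⟨hγZ t, mem_univ _⟩)
      (fun t => ⟨hs ▸ hasDerivAt_const t (γ s), mem_univ _⟩) rfl
    obtain ⟨p, q, hpq⟩ := hnonconst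
    exact hpq ((congrFun this p).trans (congrFun this q).symm)
  obtain ⟨K, hK, hphase⟩ := exists_phase_correction (F := fun u => (H u, C u)) (g := (h, c)) hT
    (fun s => ((hH1.contDiffAt (hV.mem_nhds (hγV s))).hasStrictFDerivAt one_ne_zero).prodMk
      ((hC1.contDiffAt (hV.mem_nhds (hγV s))).hasStrictFDerivAt one_ne_zero))
    (fun s => hasStrictDerivAt_of_hasDerivAt_of_continuousAt (f' := fun t => Z (γ t))
      (Eventually.of_forall hγZ) (hZL.continuous.comp hγc).continuousAt) hw
    (fun s v hv hwv => by
      rw [ContinuousLinearMap.prod_apply, Prod.mk_eq_zero, ← inner_gradient, ← inner_gradient] at hv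
      have hws := hw s
      rw [hZΓ, hX] at hwv hws
      rw [real_inner_smul_left] at hwv
      exact eq_zero_of_inner_cross3 (hind _ (hγV s)) hv.1 hv.2
        ((mul_eq_zero.1 hwv).resolve_left (left_ne_zero_of_smul hws)))
    (fun s => by simp [hHγ, hCγ]) hper
  set η := min (1 / K) ρ with hη
  have hη0 : 0 < η := lt_min (by positivity) hρ
  have hcorr : ∀ u, C u = c → ∀ s, dist u (γ s) < η → ∃ s' : ℝ,
      |s' - s| ≤ K * dist u (γ s) ∧ dist u (γ s') ≤ K * |H u - h| := fun u hu s hs => by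
    obtain ⟨s', h1, h2⟩ := hphase s u (hs.trans_le (min_le_left _ _))
    exact ⟨s', h1, by simpa [hu, Prod.norm_def] using h2⟩
  have hexists : ∀ u, Metric.infDist u Γ < η → ∃ s, dist u (γ s) < η := fun u hu => by
    obtain ⟨p, hp, hup⟩ := (Metric.infDist_lt_iff hne).1 hu
    rw [hΓr] at hp
    obtain ⟨s, rfl⟩ := hp
    exact ⟨s, hup⟩
  have hdist : ∀ u, Metric.infDist u Γ < η → C u = c → Metric.infDist u Γ ≤ K * |H u - h| :=
    fun u hu hCu => by
      obtain ⟨s, hs⟩ := hexists u hu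
      obtain ⟨s', -, h2⟩ := hcorr u hCu s hs
      exact (Metric.infDist_le_dist_of_mem (hγΓ s')).trans h2
  have htube : ∀ u, Metric.infDist u Γ < η → u ∈ Metric.cthickening ρ Γ := fun u hu =>
    Metric.thickening_subset_cthickening _ _
      ((Metric.mem_thickening_iff_infDist_lt hne).2 (hu.trans_le (min_le_right _ _)))
  have hnear : ∀ ε > 0, ∃ δ > 0, ∀ u, Metric.infDist u Γ < δ → |H u - h| < ε := by
    intro ε hε
    have hopen : IsOpen (V ∩ H ⁻¹' Metric.ball h ε) :=
      hH1.continuousOn.isOpen_inter_preimage hV Metric.isOpen_ball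
    obtain ⟨δ, hδ, hsub⟩ := hΓc.exists_thickening_subset_open hopen (by
      rw [hΓr]
      rintro _ ⟨t, rfl⟩
      exact ⟨hγV t, by simp [hHγ, hε]⟩)
    exact ⟨δ, hδ, fun u hu =>
      (hsub ((Metric.mem_thickening_iff_infDist_lt hne).2 hu)).2⟩
  obtain ⟨δ₁, hδ₁, hδH⟩ := hnear (η / (K * Real.exp L)) (by positivity)
  have hsmall : ∀ u, Metric.infDist u Γ < δ₁ → K * |H u - h| * Real.exp L < η := fun u hu => by
    have := (lt_div_iff₀ (by positivity)).1 (hδH u hu)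
    linarith
  have hsmall' : ∀ u, Metric.infDist u Γ < δ₁ → K * |H u - h| < η := fun u hu =>
    (le_mul_of_one_le_right (by positivity) (Real.one_le_exp L.coe_nonneg)).trans_lt (hsmall u hu)
  have hest : ∀ x : ℝ → E3, Metric.infDist (x 0) Γ < min δ₁ η → C (x 0) = c →
      ContinuousOn x (Ici 0) →
      (∀ t ≥ 0, Metric.infDist (x t) Γ < η → HasDerivWithinAt x (Y (x t)) (Ici 0) t) →
      ∀ t ≥ 0, Metric.infDist (x t) Γ < η ∧ C (x t) = c ∧
        |H (x t) - h| ≤ Real.exp (-a * t) * |H (x 0) - h| ∧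
        Metric.infDist (x t) Γ ≤ K * |H (x t) - h| := fun x hx0 hCx hxc hx =>
    tube_estimates ha.le hK.le
      (fun u hu => (hH1.contDiffAt (hV.mem_nhds (hρV (htube u hu)))).differentiableAt one_ne_zero)
      (fun u hu => (hC1.contDiffAt (hV.mem_nhds (hρV (htube u hu)))).differentiableAt one_ne_zero)
      (fun u _ => hHY u) (fun u _ => hCY u) (fun u hu => haβ u (htube u hu)) hdist hxc hx
      (hx0.trans_le (min_le_right _ _)) hCx (hsmall' _ (hx0.trans_le (min_le_left _ _)))
  have hfwd : ∀ x₀ ∈ C ⁻¹' {c} ∩ V, Metric.infDist x₀ Γ < min δ₁ η → ∀ x : ℝ → E3,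
      IsForwardSolution Y V x₀ x → ∀ t ≥ 0, Metric.infDist (x t) Γ < η ∧ C (x t) = c ∧
        |H (x t) - h| ≤ Real.exp (-a * t) * |H x₀ - h| ∧
        Metric.infDist (x t) Γ ≤ K * |H (x t) - h| := by
    rintro x₀ ⟨hx₀, -⟩ hd x ⟨rfl, hx⟩
    exact hest x hd hx₀ (fun t ht => (hx t ht).2.continuousWithinAt) fun t ht _ => (hx t ht).2
  refine ⟨min δ₁ η, lt_min hδ₁ hη0, ?_, fun ε hε => ?_, fun x₀ hx₀ hd x hx => ?_⟩
  · rintro x₀ ⟨hx₀, -⟩ hd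
    obtain ⟨x, rfl, hx⟩ := exists_forall_hasDerivWithinAt_Ici hZL hZB x₀
    have hxt := hest x hd hx₀ (fun t ht => (hx t ht).continuousWithinAt)
      fun t ht htu => hZY (htube _ htu) ▸ hx t ht
    refine ⟨x, rfl, fun t ht => ?_⟩
    have hmem := htube _ (hxt t ht).1
    exact ⟨hρV hmem, hZY hmem ▸ hx t ht⟩
  · obtain ⟨δ₂, hδ₂, hδ₂H⟩ := hnear (ε / K) (by positivity)
    refine ⟨min (min δ₁ η) δ₂, lt_min (lt_min hδ₁ hη0) hδ₂, min_le_left _ _,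
      fun x₀ hx₀ hd x hx t ht => ?_⟩
    obtain ⟨-, -, h1, h2⟩ := hfwd x₀ hx₀ (hd.trans_le (min_le_left _ _)) x hx t ht
    have h3 : |H (x t) - h| ≤ |H x₀ - h| :=
      h1.trans (mul_le_of_le_one_left (abs_nonneg _) (Real.exp_le_one_iff.2 (by nlinarith)))
    have h4 := (lt_div_iff₀ hK).1 (hδ₂H x₀ (hd.trans_le (min_le_right _ _)))
    nlinarith
  · have hxt := hfwd x₀ hx₀ hd x hx
    obtain ⟨hx0, hxV⟩ := hx
    have hdecay : ∀ t ≥ 0, K * |H (x t) - h| ≤ K * |H x₀ - h| * Real.exp (-a * t) :=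
      fun t ht => by
        rw [mul_assoc, mul_comm |H x₀ - h|]
        exact mul_le_mul_of_nonneg_left (hxt t ht).2.2.1 hK.le
    constructor
    · have hlim : Tendsto (fun t => K * |H x₀ - h| * Real.exp (-a * t)) atTop (𝓝 0) := by
        have h1 : Tendsto (fun t : ℝ => -a * t) atTop atBot :=
          tendsto_id.const_mul_atTop_of_neg (by linarith)
        simpa using (Real.tendsto_exp_atBot.comp h1).const_mul (K * |H x₀ - h|)
      refine squeeze_zero' (Eventually.of_forall fun _ => Metric.infDist_nonneg) ?_ hlim
      filter_upwards [eventually_ge_atTop 0] with t ht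
      exact (hxt t ht).2.2.2.trans (hdecay t ht)
    · have hγB : LipschitzWith B γ :=
        lipschitzWith_of_nnnorm_deriv_le (fun t => (hγZ t).differentiableAt) fun t => by
          rw [(hγZ t).deriv]; exact hZB _
      refine exists_asymptotic_phase (η := η) hZL hγZ hγB
        (fun t ht => (hZY (htube _ (hxt t ht).1)).symm ▸ (hxV t ht).2) ha hK.le
        (fun t ht s hs => ?_) (hsmall x₀ (hd.trans_le (min_le_left _ _)))
        (hexists _ (hxt 0 le_rfl).1)
      obtain ⟨s', h1, h2⟩ := hcorr _ (hxt t ht).2.1 s hs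
      exact ⟨s', h1, h2.trans (hdecay t ht)⟩
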